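/- arXiv:cond-mat/0605150 — 5 statements merged into one kernel-verified Lean document; each statement's English description precedes it below -/
import Mathlib

section
/- For all configurations X, X′ of P particles: T₀(X,X′) = T(ι(X′), ι(X)), where ι(X) denotes the reversed-negated configuration with ι(X)_i := −x_{P+1−i}. -/
open Finset

namespace TASEP

attribute [local instance] Classical.propDecidable

noncomputable section

/-- Generalized binomial coefficient `C(n,k) = n(n-1)⋯(n-k+1)/k!` for `n : ℤ`, `k : ℕ`. -/
def C (n : ℤ) (k : ℕ) : ℝ :=
  (∏ i ∈ Finset.range k, ((n : ℝ) - (i : ℝ))) / (k.factorial : ℝ)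

/-- `λ = v/(1-v)`. -/
def lam (v : ℝ) : ℝ := v / (1 - v)

/-- The matrix element `f(a,b,t)` of the determinant solution of the parallel TASEP. -/
def f (v : ℝ) (a b : ℤ) (t : ℕ) : ℝ :=
  if 1 ≤ a then
    (1 - v) ^ t * (-1 : ℝ) ^ a *
      ∑' k : ℕ, if 0 ≤ b + (k : ℤ) then
        C ((t : ℤ) + a) (b + (k : ℤ)).toNat * C (a + (k : ℤ) - 1) k *
          lam v ^ (b + (k : ℤ)).toNat
      else 0
  else
    (1 - v) ^ t * (-1 : ℝ) ^ a *
      ∑' j : ℕ, if (j : ℤ) ≤ -a ∧ 0 ≤ b + (j : ℤ) then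
        (-1 : ℝ) ^ j * C (-a) j * C ((t : ℤ) + a) (b + (j : ℤ)).toNat *
          lam v ^ (b + (j : ℤ)).toNat
      else 0

/-- Number of pairs of neighboring particles (occupied neighboring sites) in `x`. -/
def nPairs {P : ℕ} (x : Fin P → ℤ) : ℕ :=
  (Finset.univ.filter fun p : Fin P × Fin P =>
    ((p.2 : ℕ) = (p.1 : ℕ) + 1) ∧ x p.2 = x p.1 + 1).card

/-- Number of clusters `N_c(x) = P - nPairs x`. -/
def Nc {P : ℕ} (x : Fin P → ℤ) : ℕ := P - nPairs x

/-- The matrix `F(X,Y,t)` with entries `f(i-j, x_i - y_j, t)`. -/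
def Fmat (v : ℝ) {P : ℕ} (x y : Fin P → ℤ) (t : ℕ) : Matrix (Fin P) (Fin P) ℝ :=
  Matrix.of fun i j => f v ((i : ℤ) - (j : ℤ)) (x i - y j) t

/-- One-step transition probability of the parallel-update TASEP. -/
def Tstep (v : ℝ) {P : ℕ} (x x' : Fin P → ℤ) : ℝ :=
  ∏ i : Fin P,
    if x i = x' i + 1 ∧ (∀ j : Fin P, (j : ℕ) = (i : ℕ) + 1 → x' i + 1 < x' j) then v
    else if x i = x' i ∧ (∀ j : Fin P, (j : ℕ) = (i : ℕ) + 1 → x' i + 1 < x' j) then 1 - v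
    else if x i = x' i ∧ (∃ j : Fin P, (j : ℕ) = (i : ℕ) + 1 ∧ x' j = x' i + 1) then 1
    else 0

/-- Transformed transition probability `T₀(X,X') = (1-v)^(N_c(X)-N_c(X')) T(X,X')`. -/
def T0 (v : ℝ) {P : ℕ} (x x' : Fin P → ℤ) : ℝ :=
  (1 - v) ^ ((Nc x : ℤ) - (Nc x' : ℤ)) * Tstep v x x'

/-- `shiftBy x k` subtracts `1` from the coordinates selected by `k`. -/
def shiftBy {P : ℕ} (x : Fin P → ℤ) (k : Fin P → Bool) : Fin P → ℤ :=
  fun i => x i - if k i then 1 else 0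

/-- `t`-step probability of the parallel-update TASEP started from `x0`. -/
def Pt (v : ℝ) {P : ℕ} (x0 : Fin P → ℤ) : ℕ → (Fin P → ℤ) → ℝ
  | 0 => fun x => if x = x0 then 1 else 0
  | t + 1 => fun x => ∑ k : Fin P → Bool,
      if StrictMono (shiftBy x k) then
        Tstep v x (shiftBy x k) * Pt v x0 t (shiftBy x k)
      else 0

/-- One-particle weight `F₀(x|t)`. -/
def F0 (v : ℝ) (x : ℤ) (t : ℕ) : ℝ :=
  if 0 ≤ x ∧ x ≤ (t : ℤ) then (t.choose x.toNat : ℝ) * v ^ x.toNat * (1 - v) ^ (t - x.toNat)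
  else 0

/-- Schütz's functions `F_m(N|t)` for the backward sequential update. -/
def Fm (v : ℝ) (m : ℤ) (N : ℤ) (t : ℕ) : ℝ :=
  if 0 < m then
    ∑' k : ℕ, ((k + m.toNat - 1).choose (m.toNat - 1) : ℝ) * F0 v (N + (k : ℤ)) t
  else if m = 0 then F0 v N t
  else
    ∑ k ∈ Finset.range (m.natAbs + 1),
      (-1 : ℝ) ^ k * (m.natAbs.choose k : ℝ) * F0 v (N + (k : ℤ)) t

/-- The functions `F̃_m(N|t)` for the parallel update. -/
def Ftil (v : ℝ) (m : ℤ) (N : ℤ) (t : ℕ) : ℝ :=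
  if 0 < m then
    ∑ n ∈ Finset.range (m.toNat + 1),
      ∑' k : ℤ, if -(n : ℤ) ≤ k then
        (m.toNat.choose n : ℝ) * ((m + (n : ℤ) + k - 1).toNat.choose ((n : ℤ) + k).toNat : ℝ) *
          lam v ^ n * F0 v (N + k) t
      else 0
  else if m = 0 then F0 v N t
  else
    ∑ n ∈ Finset.range (m.natAbs + 1),
      ∑' k : ℤ, if -(n : ℤ) ≤ k then
        (-1 : ℝ) ^ n * (m.natAbs.choose n : ℝ) *
          (((m.natAbs : ℤ) + (n : ℤ) + k - 1).toNat.choose ((n : ℤ) + k).toNat : ℝ) *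
          (-(lam v)) ^ ((n : ℤ) + k).toNat * F0 v (N - k) t
      else 0

/-- One-step transition probability of the TASEP with backward sequential update. -/
def TBw (v : ℝ) {P : ℕ} (x x' : Fin P → ℤ) : ℝ :=
  ∏ i : Fin P,
    if h : (i : ℕ) + 1 < P then
      if x' i + 1 < x' ⟨(i : ℕ) + 1, h⟩ ∨
          (x' ⟨(i : ℕ) + 1, h⟩ = x' i + 1 ∧ x ⟨(i : ℕ) + 1, h⟩ = x' ⟨(i : ℕ) + 1, h⟩ + 1) then
        (if x i = x' i + 1 then v else if x i = x' i then 1 - v else 0)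
      else if x' ⟨(i : ℕ) + 1, h⟩ = x' i + 1 ∧ x ⟨(i : ℕ) + 1, h⟩ = x' ⟨(i : ℕ) + 1, h⟩ then
        (if x i = x' i then 1 else 0)
      else 0
    else
      (if x i = x' i + 1 then v else if x i = x' i then 1 - v else 0)

/-- `t`-step probability of the backward-sequential-update TASEP started from `x0`. -/
def Pbw (v : ℝ) {P : ℕ} (x0 : Fin P → ℤ) : ℕ → (Fin P → ℤ) → ℝ
  | 0 => fun x => if x = x0 then 1 else 0
  | t + 1 => fun x => ∑ k : Fin P → Bool,
      if StrictMono (shiftBy x k) then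
        TBw v x (shiftBy x k) * Pbw v x0 t (shiftBy x k)
      else 0

/-- Reversed-negated configuration `ι(X)_i = -x_{P+1-i}`. -/
def iota {P : ℕ} (x : Fin P → ℤ) : Fin P → ℤ := fun i => - x i.rev

/-- `i` is a cluster head of `x` (first particle of a cluster). -/
def isHead {P : ℕ} (x : Fin P → ℤ) (i : Fin P) : Prop :=
  ∀ j : Fin P, (i : ℕ) = (j : ℕ) + 1 → x j + 1 < x i

/-- Position of the `i`-th walker at time `s`, given steps `ε`. -/
def walkerPos {P t : ℕ} (x0 : Fin P → ℤ) (ε : Fin P → Fin t → Bool) (i : Fin P) (s : ℕ) : ℤ :=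
  x0 i + ((Finset.univ.filter fun u : Fin t => (u : ℕ) < s ∧ ε i u = true).card : ℤ)

/-- General Bethe-ansatz sum with amplitudes `A`. -/
def betheSum {P : ℕ} (z : Fin P → ℂ) (A : Equiv.Perm (Fin P) → ℂ) (x : Fin P → ℤ) : ℂ :=
  ∑ σ : Equiv.Perm (Fin P), A σ * ∏ i : Fin P, z (σ i) ^ (-(x i))

/-- `ξ(z) = -(1+λz)/(1-1/z)`. -/
def xiC (v : ℝ) (z : ℂ) : ℂ := -(1 + (lam v : ℂ) * z) / (1 - 1 / z)

/-- Bethe amplitudes `A_σ = sgn(σ) ∏ ξ_{σ(i)}^{i-σ(i)}`. -/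
def ampA (v : ℝ) {P : ℕ} (z : Fin P → ℂ) (σ : Equiv.Perm (Fin P)) : ℂ :=
  ((Equiv.Perm.sign σ : ℤ) : ℂ) * ∏ i : Fin P, xiC v (z (σ i)) ^ ((i : ℤ) - (σ i : ℤ))

/-- The Bethe eigenfunction `B(x)`. -/
def betheB (v : ℝ) {P : ℕ} (z : Fin P → ℂ) (x : Fin P → ℤ) : ℂ :=
  betheSum z (ampA v z) x

/-- `i` is the last particle of a cluster of `x`: the site in front of it is empty. -/
def IsTail {P : ℕ} (x : Fin P → ℤ) (i : Fin P) : Prop :=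
  ∀ j : Fin P, (j : ℕ) = (i : ℕ) + 1 → x i + 1 < x j

/-- A parallel-update step from `x'` to `x` is admissible if every particle stays or hops by one,
and only particles with an empty site in front of them hop. -/
def IsAdmissible {P : ℕ} (x x' : Fin P → ℤ) : Prop :=
  ∀ i, x i = x' i ∨ x i = x' i + 1 ∧ IsTail x' i

theorem not_isTail_iff {P : ℕ} {x : Fin P → ℤ} (hx : StrictMono x) (i : Fin P) :
    ¬ IsTail x i ↔ ∃ j : Fin P, (j : ℕ) = (i : ℕ) + 1 ∧ x j = x i + 1 := by
  simp only [IsTail]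
  push Not
  refine exists_congr fun j => and_congr_right fun hj => ?_
  have : x i < x j := hx (by rw [Fin.lt_def]; omega)
  omega

theorem nPairs_eq_card_not_isTail {P : ℕ} {x : Fin P → ℤ} (hx : StrictMono x) :
    nPairs x = (univ.filter fun i => ¬ IsTail x i).card := by
  refine Finset.card_bij (fun p _ => p.1) ?_ ?_ ?_
  · rintro ⟨i, j⟩ h
    simp only [mem_filter, mem_univ, true_and] at h ⊢
    exact (not_isTail_iff hx i).2 ⟨j, h⟩
  · rintro ⟨i, j⟩ h ⟨i', j'⟩ h' rfl
    simp only [mem_filter, mem_univ, true_and] at h h'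
    exact Prod.ext rfl (Fin.ext (h.1.trans h'.1.symm))
  · intro i h
    simp only [mem_filter, mem_univ, true_and] at h
    obtain ⟨j, hj⟩ := (not_isTail_iff hx i).1 h
    exact ⟨(i, j), by simpa using hj, rfl⟩

theorem Nc_eq_card_isTail {P : ℕ} {x : Fin P → ℤ} (hx : StrictMono x) :
    Nc x = (univ.filter fun i => IsTail x i).card := by
  have h := Finset.card_filter_add_card_filter_not (s := (univ : Finset (Fin P)))
    (fun i => IsTail x i)
  rw [← nPairs_eq_card_not_isTail hx, card_univ, Fintype.card_fin] at h
  unfold Nc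
  omega

/-- The one-step probability depends on the starting configuration only through admissibility
and the number of clusters. -/
theorem Tstep_eq_ite {v : ℝ} (hv1 : v < 1) {P : ℕ} (x : Fin P → ℤ) {x' : Fin P → ℤ}
    (hx' : StrictMono x') :
    Tstep v x x' = if IsAdmissible x x' then
      (∏ i, if x i = x' i + 1 then lam v else 1) * (1 - v) ^ Nc x' else 0 := by
  have hv : 1 - v ≠ 0 := by linarith
  unfold Tstep
  split_ifs with h
  · rw [Nc_eq_card_isTail hx', ← Finset.prod_const, Finset.prod_filter, ← Finset.prod_mul_distrib]
    refine Finset.prod_congr rfl fun i _ => ?_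
    rcases h i with hi | ⟨hi, ht⟩
    · have hne : x i ≠ x' i + 1 := by omega
      by_cases ht : IsTail x' i
      · rw [if_neg fun h => hne h.1, if_pos ⟨hi, ht⟩, if_neg hne, if_pos ht, one_mul]
      · rw [if_neg fun h => ht h.2, if_neg fun h => ht h.2,
          if_pos ⟨hi, (not_isTail_iff hx' i).1 ht⟩, if_neg hne, if_neg ht, one_mul]
    · rw [if_pos ⟨hi, ht⟩, if_pos hi, if_pos ht, lam, div_mul_cancel₀ _ hv]
  · obtain ⟨i, hi⟩ := not_forall.1 h
    push Not at hi
    refine Finset.prod_eq_zero (mem_univ i) ?_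
    rw [if_neg fun h => hi.2 h.1 h.2, if_neg fun h => hi.1 h.1, if_neg fun h => hi.1 h.1]

theorem strictMono_iota {P : ℕ} {x : Fin P → ℤ} (hx : StrictMono x) : StrictMono (iota x) :=
  fun _ _ h => neg_lt_neg (hx (Fin.rev_lt_rev.2 h))

theorem iota_iota {P : ℕ} (x : Fin P → ℤ) : iota (iota x) = x := by
  funext i
  simp [iota]

theorem nPairs_iota {P : ℕ} (x : Fin P → ℤ) : nPairs (iota x) = nPairs x := by
  refine Finset.card_nbij' (fun p => (p.2.rev, p.1.rev)) (fun p => (p.2.rev, p.1.rev)) ?_ ?_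
    (fun p _ => by simp) (fun p _ => by simp)
  all_goals
    rintro ⟨i, j⟩ h
    simp only [mem_coe, mem_filter, mem_univ, true_and] at h ⊢
    simp only [iota, Fin.rev_rev, Fin.val_rev] at h ⊢
    omega

theorem Nc_iota {P : ℕ} (x : Fin P → ℤ) : Nc (iota x) = Nc x := by
  rw [Nc, Nc, nPairs_iota]

/-- Admissibility is preserved by time reversal: a particle that hops ends up at least two
sites in front of its follower, so it can hop back. -/
theorem IsAdmissible.iota {P : ℕ} {x x' : Fin P → ℤ} (hx' : StrictMono x')
    (h : IsAdmissible x x') : IsAdmissible (iota x') (iota x) := by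
  intro i
  simp only [IsTail, TASEP.iota]
  rcases h i.rev with hi | ⟨hi, -⟩
  · exact Or.inl (by rw [hi])
  · refine Or.inr ⟨by omega, fun j hj => ?_⟩
    have hval : (i.rev : ℕ) = (j.rev : ℕ) + 1 := by simp only [Fin.val_rev]; omega
    have hlt : x' j.rev < x' i.rev := hx' (by rw [Fin.lt_def]; omega)
    rcases h j.rev with hj' | ⟨hj', ht⟩
    · omega
    · have := ht _ hval
      omega

theorem isAdmissible_iota_iff {P : ℕ} {x x' : Fin P → ℤ} (hx : StrictMono x)
    (hx' : StrictMono x') : IsAdmissible (iota x') (iota x) ↔ IsAdmissible x x' := by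
  refine ⟨fun h => ?_, IsAdmissible.iota hx'⟩
  simpa only [iota_iota] using h.iota (strictMono_iota hx)

theorem prod_hops_iota (a : ℝ) {P : ℕ} (x x' : Fin P → ℤ) :
    (∏ i, if iota x' i = iota x i + 1 then a else 1) = ∏ i, if x i = x' i + 1 then a else 1 := by
  refine Fintype.prod_equiv Fin.revPerm _ _ fun i => if_congr ?_ rfl rfl
  simp only [iota, Fin.revPerm_apply]
  omega

/-- `T₀(X,X') = T(ι(X'), ι(X))` where `ι` is the reversed-negated configuration. -/
theorem T0_eq_T_reversed
    (v : ℝ) (hv0 : 0 < v) (hv1 : v < 1) (P : ℕ) (hP : 1 ≤ P)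
    (x x' : Fin P → ℤ) (hx : StrictMono x) (hx' : StrictMono x') :
    T0 v x x' = Tstep v (iota x') (iota x) := by
  have hv : 1 - v ≠ 0 := by linarith
  rw [T0, Tstep_eq_ite hv1 x hx', Tstep_eq_ite hv1 _ (strictMono_iota hx), prod_hops_iota, Nc_iota,
    if_congr (isAdmissible_iota_iff hx hx') rfl rfl]
  split_ifs
  · rw [zpow_sub₀ hv, zpow_natCast, zpow_natCast]
    field_simp
  · rw [mul_zero]

end

end TASEP
end

section
/- For every x ∈ ℤ^P, every j ∈ {1,…,P−1} and every c ∈ ℤ, writing x[u,w] for the tuple obtained from x by replacing its j-th and (j+1)-th coordinates by u and w respectively: v·(B(x[c−1,c]) − B(x[c−1,c+1])) + (1−v)·(B(x[c,c]) − B(x[c,c+1])) = 0. -/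
open Finset

namespace TASEP

attribute [local instance] Classical.propDecidable

noncomputable section

theorem xiC_ne_zero {v : ℝ} (hv0 : 0 < v) (hv1 : v < 1) {z : ℂ}
    (hz : z ≠ 0 ∧ z ≠ 1 ∧ z ≠ -(((1 - v) / v : ℝ) : ℂ)) : xiC v z ≠ 0 := by
  obtain ⟨h0, h1, h2⟩ := hz
  have hv : (v : ℂ) ≠ 0 := by exact_mod_cast hv0.ne'
  have hv' : (1 - v : ℂ) ≠ 0 := by exact_mod_cast (sub_pos.2 hv1).ne'
  refine div_ne_zero (neg_ne_zero.2 fun h => h2 ?_) (sub_ne_zero.2 fun h => h1 ?_)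
  · simp only [lam, Complex.ofReal_div, Complex.ofReal_sub, Complex.ofReal_one] at h ⊢
    field_simp at h ⊢
    linear_combination h
  · field_simp at h
    exact h

/-- The weight of a pair of adjacent slots carrying `a` and `b`, with the amplitude factor
`ξ` of `a` absorbed. -/
theorem pair_weight {v : ℝ} (hv1 : v < 1) {a b : ℂ} (ha : a ≠ 0) (ha1 : a ≠ 1) (hb : b ≠ 0)
    (c : ℤ) :
    (v : ℂ) * (a ^ (-(c - 1)) * b ^ (-c) - a ^ (-(c - 1)) * b ^ (-(c + 1)))
      + (1 - v) * (a ^ (-c) * b ^ (-c) - a ^ (-c) * b ^ (-(c + 1))) =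
    -(1 - v) * xiC v a * (((1 - 1 / a) * a ^ (-c)) * ((1 - 1 / b) * b ^ (-c))) := by
  have hv' : (1 - v : ℂ) ≠ 0 := by exact_mod_cast (sub_pos.2 hv1).ne'
  have hxi : (1 - v) * (xiC v a * (1 - 1 / a)) = -(1 - v + v * a) := by
    have h : 1 - 1 / a ≠ 0 := sub_ne_zero.2 fun h => ha1 (by field_simp at h; exact h)
    rw [xiC, div_mul_cancel₀ _ h, lam]
    push_cast
    field_simp
  have e1 : a ^ (-(c - 1)) = a ^ (-c) * a := by
    rw [← zpow_add_one₀ ha]; congr 1; ring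
  have e2 : b ^ (-(c + 1)) = b ^ (-c) * (1 / b) := by
    rw [one_div, ← zpow_sub_one₀ hb]; congr 1; ring
  rw [e1, e2]
  linear_combination (a ^ (-c) * b ^ (-c) * (1 - 1 / b)) * hxi

/-- A signed sum over permutations of products of entries vanishes if two columns agree. -/
theorem sum_sign_mul_prod_eq_zero {n : Type*} [Fintype n] [DecidableEq n] (h : n → n → ℂ)
    {j k : n} (hjk : j ≠ k) (hh : h j = h k) :
    ∑ σ : Equiv.Perm n, ((Equiv.Perm.sign σ : ℤ) : ℂ) * ∏ i, h i (σ i) = 0 := by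
  have := Matrix.det_zero_of_column_eq (M := Matrix.of fun a i => h i a) hjk
    fun a => congrFun hh a
  rw [Matrix.det_apply'] at this
  exact this

theorem prod_split {n : Type*} [Fintype n] [DecidableEq n] {j k : n} (hjk : j ≠ k) (F : n → ℂ) :
    ∏ i, F i = F j * F k * ∏ i ∈ (univ.erase j).erase k, F i := by
  rw [mul_assoc, Finset.mul_prod_erase _ _ (by simp [hjk.symm]),
    Finset.mul_prod_erase _ _ (mem_univ _)]

/-- The Bethe-ansatz constraint relation for the function `B` at a pair of neighbouring
coordinate slots `j`, `j+1`. -/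
theorem bethe_constraint
    (v : ℝ) (hv0 : 0 < v) (hv1 : v < 1) (P : ℕ) (hP : 1 ≤ P)
    (z : Fin P → ℂ)
    (hz : ∀ i, z i ≠ 0 ∧ z i ≠ 1 ∧ z i ≠ -(((1 - v) / v : ℝ) : ℂ))
    (x : Fin P → ℤ) (j : Fin P) (hj : (j : ℕ) + 1 < P) (c : ℤ) :
    (v : ℂ) *
        (betheB v z (fun i => if (i : ℕ) = (j : ℕ) then c - 1
            else if (i : ℕ) = (j : ℕ) + 1 then c else x i)
          - betheB v z (fun i => if (i : ℕ) = (j : ℕ) then c - 1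
            else if (i : ℕ) = (j : ℕ) + 1 then c + 1 else x i))
      + ((1 - v : ℝ) : ℂ) *
        (betheB v z (fun i => if (i : ℕ) = (j : ℕ) then c
            else if (i : ℕ) = (j : ℕ) + 1 then c else x i)
          - betheB v z (fun i => if (i : ℕ) = (j : ℕ) then c
            else if (i : ℕ) = (j : ℕ) + 1 then c + 1 else x i)) = 0 := by
  obtain ⟨k, hk⟩ : ∃ k : Fin P, (k : ℕ) = (j : ℕ) + 1 := ⟨⟨_, hj⟩, rfl⟩
  have hjk : j ≠ k := fun h => by rw [h] at hk; omega
  have hkj : (k : ℕ) ≠ j := by omega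
  let h : Fin P → Fin P → ℂ := fun i a =>
    if i = j ∨ i = k then
      xiC v (z a) ^ ((k : ℤ) - (a : ℤ)) * ((1 - 1 / z a) * z a ^ (-c))
    else xiC v (z a) ^ ((i : ℤ) - (a : ℤ)) * z a ^ (-x i)
  have hh : h j = h k := by funext a; simp [h]
  have key := sum_sign_mul_prod_eq_zero h hjk hh
  rw [← mul_zero (-(1 - v : ℂ)), ← key]
  simp only [betheB, betheSum, ← sum_sub_distrib, mul_sum, ← sum_add_distrib]
  refine sum_congr rfl fun σ _ => ?_
  have hprod (u w : ℤ) : ∏ i, z (σ i) ^ (-(if (i : ℕ) = (j : ℕ) then u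
      else if (i : ℕ) = (j : ℕ) + 1 then w else x i)) =
      z (σ j) ^ (-u) * z (σ k) ^ (-w) * ∏ i ∈ (univ.erase j).erase k, z (σ i) ^ (-x i) := by
    rw [prod_split hjk]
    congr 1
    · simp [hk]
    · refine prod_congr rfl fun i hi => ?_
      simp only [mem_erase, mem_univ, and_true, ne_eq, Fin.ext_iff] at hi
      rw [if_neg hi.2, if_neg (hk ▸ hi.1)]
  have hrest : ∏ i ∈ (univ.erase j).erase k, h i (σ i) =
      (∏ i ∈ (univ.erase j).erase k, xiC v (z (σ i)) ^ ((i : ℤ) - (σ i : ℤ))) *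
        ∏ i ∈ (univ.erase j).erase k, z (σ i) ^ (-x i) := by
    rw [← prod_mul_distrib]
    refine prod_congr rfl fun i hi => ?_
    simp only [mem_erase, mem_univ, and_true, ne_eq] at hi
    simp [h, hi.1, hi.2]
  have hxi : xiC v (z (σ j)) ^ ((k : ℤ) - (σ j : ℤ)) =
      xiC v (z (σ j)) ^ ((j : ℤ) - (σ j : ℤ)) * xiC v (z (σ j)) := by
    rw [← zpow_add_one₀ (xiC_ne_zero hv0 hv1 (hz _)), hk]
    congr 1
    push_cast
    ring
  have hhj : h j (σ j) = xiC v (z (σ j)) ^ ((j : ℤ) - (σ j : ℤ)) * xiC v (z (σ j)) *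
      ((1 - 1 / z (σ j)) * z (σ j) ^ (-c)) := by
    rw [← hxi]; simp [h]
  have hhk : h k (σ k) = xiC v (z (σ k)) ^ ((k : ℤ) - (σ k : ℤ)) *
      ((1 - 1 / z (σ k)) * z (σ k) ^ (-c)) := by
    simp [h]
  have hw := pair_weight hv1 (hz (σ j)).1 (hz (σ j)).2.1 (hz (σ k)).1 c
  simp only [hprod]
  rw [ampA, prod_split hjk (fun i => xiC v (z (σ i)) ^ ((i : ℤ) - (σ i : ℤ))),
    prod_split hjk (fun i => h i (σ i)), hrest, hhj, hhk, Complex.ofReal_sub, Complex.ofReal_one]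
  generalize ∏ i ∈ (univ.erase j).erase k, xiC v (z (σ i)) ^ ((i : ℤ) - (σ i : ℤ)) = R
  generalize ∏ i ∈ (univ.erase j).erase k, z (σ i) ^ (-x i) = S
  generalize xiC v (z (σ j)) ^ ((j : ℤ) - (σ j : ℤ)) = X at *
  generalize xiC v (z (σ k)) ^ ((k : ℤ) - (σ k : ℤ)) = Y at *
  linear_combination (((Equiv.Perm.sign σ : ℤ) : ℂ) * X * Y * R * S) * hw

end

end TASEP
end

section
/- For every configuration X of P particles: Σ_{X′} T₀(X,X′)·B(X′) = (1−v)^P·(∏_{i=1}^P (1+λ z_i))·B(X), the (finite) sum running over all configurations X′ with x_i − 1 ≤ x′_i ≤ x_i for every i; that is, the Bethe-ansatz function B is an eigenfunction of the transformed evolution operator T₀ with eigenvalue Λ(Z) = (1−v)^P·∏_{i=1}^P(1+λ z_i). -/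
open Finset

namespace TASEP

attribute [local instance] Classical.propDecidable

noncomputable section

lemma xiC_ne_zero_s15 {v : ℝ} (hv0 : 0 < v) (hv1 : v < 1) {w : ℂ} (h0 : w ≠ 0) (h1 : w ≠ 1)
    (h2 : w ≠ -(((1 - v) / v : ℝ) : ℂ)) : xiC v w ≠ 0 := by
  have hv : (v : ℂ) ≠ 0 := by exact_mod_cast hv0.ne'
  have hv' : (1 - v : ℂ) ≠ 0 := by exact_mod_cast (sub_pos.2 hv1).ne'
  refine div_ne_zero (neg_ne_zero.2 fun h => h2 ?_) fun h => h1 ?_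
  · simp only [lam] at h
    push_cast at h ⊢
    field_simp at h ⊢
    linear_combination h
  · field_simp at h
    linear_combination h

/-- Bethe sums of product functions are determinants. -/
lemma sum_ampA_mul_prod {v : ℝ} {P : ℕ} {z : Fin P → ℂ} (hξ : ∀ i, xiC v (z i) ≠ 0)
    (φ : Fin P → ℂ → ℂ) :
    ∑ σ, ampA v z σ * ∏ i, φ i (z (σ i)) =
      (∏ m, xiC v (z m) ^ (-(m : ℤ))) *
        (Matrix.of fun m j : Fin P => xiC v (z m) ^ (j : ℤ) * φ j (z m)).det := by
  rw [Matrix.det_apply', mul_sum]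
  refine sum_congr rfl fun σ _ => ?_
  have h : ∏ i, xiC v (z (σ i)) ^ ((i : ℤ) - (σ i : ℤ)) =
      (∏ i, xiC v (z (σ i)) ^ (i : ℤ)) * ∏ m, xiC v (z m) ^ (-(m : ℤ)) := by
    rw [← Equiv.prod_comp σ fun m => xiC v (z m) ^ (-(m : ℤ)), ← prod_mul_distrib]
    exact prod_congr rfl fun i _ => by rw [sub_eq_add_neg, zpow_add₀ (hξ _)]
  simp only [ampA, h, Matrix.of_apply, prod_mul_distrib]
  ring

lemma exists_pred_of_not_isHead {P : ℕ} {x : Fin P → ℤ} (hx : StrictMono x) {i : Fin P}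
    (hi : ¬ isHead x i) : ∃ p : Fin P, (i : ℕ) = p + 1 ∧ x i = x p + 1 := by
  simp only [isHead, not_forall, not_lt] at hi
  obtain ⟨p, hp, h⟩ := hi
  have : x p < x i := hx (Fin.lt_def.2 (by omega))
  exact ⟨p, hp, by omega⟩

/-- The eigenvalue factors at particles that are not cluster heads can be dropped. -/
lemma det_eq_of_forall_not_isHead {v : ℝ} (hv1 : v < 1) {P : ℕ} {z : Fin P → ℂ}
    (h0 : ∀ i, z i ≠ 0) (h1 : ∀ i, z i ≠ 1) (hξ : ∀ i, xiC v (z i) ≠ 0) {x : Fin P → ℤ}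
    (hx : StrictMono x) (s : Finset (Fin P)) (hs : ∀ i ∈ s, ¬ isHead x i) :
    (Matrix.of fun m j : Fin P => xiC v (z m) ^ (j : ℤ) *
      ((if j ∈ s then 1 else (1 - v) * (1 + lam v * z m)) * z m ^ (-x j))).det =
    (Matrix.of fun m j : Fin P => xiC v (z m) ^ (j : ℤ) *
      ((1 - v) * (1 + lam v * z m) * z m ^ (-x j))).det := by
  induction s using Finset.induction_on_min with
  | empty => simp
  | insert a s ha ih =>
    rw [← ih fun i hi => hs i (mem_insert_of_mem hi)]
    obtain ⟨p, hp, hxp⟩ := exists_pred_of_not_isHead hx (hs a (mem_insert_self a s))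
    have hpa : p < a := Fin.lt_def.2 (by omega)
    have has : a ∉ s := fun h => (ha a h).false
    have hps : p ∉ s := fun h => (hpa.trans (ha p h)).false
    have hv' : (1 - v : ℂ) ≠ 0 := by exact_mod_cast (sub_pos.2 hv1).ne'
    rw [← Matrix.det_updateCol_add_smul_self _ hpa.ne' (-v / (1 - v) : ℂ)]
    congr 1
    ext m j
    rcases eq_or_ne j a with rfl | hj
    · have hxi : xiC v (z m) * (1 - 1 / z m) = -(1 + lam v * z m) := by
        refine div_mul_cancel₀ _ fun h => h1 m ?_
        have := h0 m
        field_simp at h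
        linear_combination h
      have hlam : (lam v : ℂ) * (1 - v) = v := by
        simp only [lam]
        push_cast
        field_simp
      have hz : z m ^ (-x j) = z m ^ (-x p) * (1 / z m) := by
        rw [hxp, neg_add, zpow_add₀ (h0 m)]
        simp
      have hj : xiC v (z m) ^ (j : ℤ) = xiC v (z m) ^ (p : ℤ) * xiC v (z m) := by
        rw [hp, Nat.cast_add, zpow_add₀ (hξ m)]
        simp
      have hzz : z m * (1 / z m) = 1 := by
        have := h0 m
        field_simp
      have hc : (-v / (1 - v) : ℂ) * (1 - v) = -v := div_mul_cancel₀ _ hv'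
      simp only [Matrix.updateCol_self, Matrix.of_apply, mem_insert, true_or, if_true, has, hps,
        hpa.ne, or_self, if_false, smul_eq_mul]
      rw [hz, hj]
      generalize xiC v (z m) ^ (p : ℤ) = A at *
      generalize z m ^ (-x p) = B at *
      generalize xiC v (z m) = X at *
      generalize (-v / (1 - v) : ℂ) = c at *
      generalize (lam v : ℂ) = l at *
      generalize 1 / z m = w at *
      linear_combination A * B * (1 + l * z m) * hc - A * B * (X * w * z m) * hlam
        - A * B * v * X * hzz - A * B * v * hxi
    · simp [hj]

lemma prod_ite_one_eq_pow {ι : Type*} [Fintype ι] (p : ι → Prop) [DecidablePred p] (c : ℝ) :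
    ∏ i, (if p i then c else 1) = c ^ (univ.filter p).card := by
  rw [prod_ite]
  simp

lemma nPairs_eq_card_not_isHead {P : ℕ} {x : Fin P → ℤ} (hx : StrictMono x) :
    nPairs x = (univ.filter fun i => ¬ isHead x i).card := by
  refine card_bij (fun p _ => p.2) ?_ ?_ ?_
  · simp only [mem_filter, mem_univ, true_and, isHead, not_forall, not_lt]
    exact fun p hp => ⟨p.1, hp.1, hp.2.le⟩
  · simp only [mem_filter, mem_univ, true_and]
    rintro ⟨a, b⟩ h ⟨c, d⟩ h' rfl
    simp only [Prod.mk.injEq, and_true]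
    exact Fin.ext (by simp only at h h'; omega)
  · simp only [mem_filter, mem_univ, true_and]
    intro i hi
    obtain ⟨p, hp⟩ := exists_pred_of_not_isHead hx hi
    exact ⟨(p, i), hp, rfl⟩

lemma nPairs_eq_card_exists_succ {P : ℕ} (x : Fin P → ℤ) :
    nPairs x =
      (univ.filter fun i : Fin P => ∃ j : Fin P, (j : ℕ) = i + 1 ∧ x j = x i + 1).card := by
  refine card_bij (fun p _ => p.1) ?_ ?_ ?_
  · simp only [mem_filter, mem_univ, true_and]
    exact fun p hp => ⟨p.2, hp⟩
  · simp only [mem_filter, mem_univ, true_and]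
    rintro ⟨a, b⟩ h ⟨c, d⟩ h' rfl
    simp only [Prod.mk.injEq, true_and]
    exact Fin.ext (by simp only at h h'; omega)
  · simp only [mem_filter, mem_univ, true_and]
    rintro i ⟨j, hj⟩
    exact ⟨(i, j), hj, rfl⟩

lemma nPairs_le {P : ℕ} (x : Fin P → ℤ) : nPairs x ≤ P := by
  rw [nPairs_eq_card_exists_succ]
  exact (card_le_univ _).trans_eq (Fintype.card_fin P)

/-- One-particle factor of the transformed one-step weight. -/
def stepWeight (v : ℝ) {P : ℕ} (x : Fin P → ℤ) (i : Fin P) (b : Bool) : ℝ :=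
  if isHead x i then (if b then v else 1 - v) else if b then 0 else 1

lemma strictMono_shiftBy {P : ℕ} {x : Fin P → ℤ} (hx : StrictMono x) {k : Fin P → Bool}
    (hk : ∀ i, ¬ isHead x i → k i = false) : StrictMono (shiftBy x k) := by
  intro i j hij
  have hlt := hx hij
  rw [Fin.lt_def] at hij
  suffices k j = true → x i + 1 < x j by
    simp only [shiftBy]
    split_ifs with h1 h2 <;> first | omega | (have := this ‹_›; omega)
  intro hkj
  have hj : isHead x j := by
    by_contra h
    simp [hk j h] at hkj
  obtain ⟨p, hp⟩ : ∃ p : Fin P, (j : ℕ) = p + 1 := ⟨⟨j - 1, by omega⟩, by simp only; omega⟩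
  have := hj p hp
  have := hx.monotone (show i ≤ p from Fin.le_def.2 (by omega))
  omega

lemma Tstep_shiftBy_eq_zero {v : ℝ} {P : ℕ} {x : Fin P → ℤ} (hx : StrictMono x)
    {k : Fin P → Bool} (hm : StrictMono (shiftBy x k)) {i : Fin P} (hi : ¬ isHead x i)
    (hki : k i = true) : Tstep v x (shiftBy x k) = 0 := by
  obtain ⟨p, hp, hxp⟩ := exists_pred_of_not_isHead hx hi
  have hlt := hm (Fin.lt_def.2 (by omega) : p < i)
  have hkp : k p = true := by
    by_contra h
    simp only [shiftBy, hki, h] at hlt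
    simp at hlt
    omega
  refine prod_eq_zero (mem_univ p) ?_
  have hno : ¬ ∀ j : Fin P, (j : ℕ) = p + 1 → shiftBy x k p + 1 < shiftBy x k j := by
    intro h
    have := h i hp
    simp [shiftBy, hki, hkp] at this
    omega
  have hne : ¬ x p = shiftBy x k p := by
    simp only [shiftBy, hkp, if_true]
    omega
  simp [hno, hne]

lemma T0_eq_prod_stepWeight {v : ℝ} (hv1 : v < 1) {P : ℕ} {x : Fin P → ℤ} (hx : StrictMono x)
    (k : Fin P → Bool) :
    (if StrictMono (shiftBy x k) then T0 v x (shiftBy x k) else 0) =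
      ∏ i, stepWeight v x i (k i) := by
  by_cases hk : ∀ i, ¬ isHead x i → k i = false
  · have hm := strictMono_shiftBy hx hk
    have hv' : (1 - v) ≠ 0 := (sub_pos.2 hv1).ne'
    have hN : (Nc x : ℤ) - Nc (shiftBy x k) = nPairs (shiftBy x k) - nPairs x := by
      have := nPairs_le x
      have := nPairs_le (shiftBy x k)
      simp only [Nc]
      omega
    rw [if_pos hm, T0, hN, zpow_sub₀ hv', zpow_natCast, zpow_natCast, div_mul_eq_mul_div,
      div_eq_iff (pow_ne_zero _ hv'), nPairs_eq_card_exists_succ, nPairs_eq_card_not_isHead hx,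
      ← prod_ite_one_eq_pow, ← prod_ite_one_eq_pow, Tstep, ← prod_mul_distrib,
      ← prod_mul_distrib]
    refine prod_congr rfl fun i _ => ?_
    by_cases hs : ∃ j : Fin P, (j : ℕ) = i + 1 ∧ shiftBy x k j = shiftBy x k i + 1
    · have hno : ¬ ∀ j : Fin P, (j : ℕ) = i + 1 → shiftBy x k i + 1 < shiftBy x k j := by
        obtain ⟨j, hj, hxj⟩ := hs
        exact fun h => (h j hj).ne' hxj
      have hki : k i = false := by
        obtain ⟨j, hj, hxj⟩ := hs
        by_contra h
        rw [Bool.not_eq_false] at h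
        have hlt := hx (Fin.lt_def.2 (by omega) : i < j)
        have hkj : k j = true := by
          by_contra h'
          simp only [shiftBy, h, h', if_true] at hxj
          simp only [if_false] at hxj
          omega
        have hhead : isHead x j := by
          by_contra h'
          simp [hk j h'] at hkj
        have := hhead i hj
        simp only [shiftBy, h, hkj, if_true] at hxj
        omega
      have hxi : shiftBy x k i = x i := by simp [shiftBy, hki]
      rw [if_pos hs, if_neg (by simp [hno]), if_neg (by simp [hno]), if_pos ⟨hxi.symm, hs⟩]
      by_cases hh : isHead x i <;> simp [stepWeight, hki, hh]
    · have hyes : ∀ j : Fin P, (j : ℕ) = i + 1 → shiftBy x k i + 1 < shiftBy x k j := by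
        intro j hj
        have := hm (Fin.lt_def.2 (by omega) : i < j)
        have : shiftBy x k j ≠ shiftBy x k i + 1 := fun h => hs ⟨j, hj, h⟩
        omega
      rw [if_neg hs]
      by_cases hki : k i = true
      · have hh : isHead x i := by
          by_contra h
          simp [hk i h] at hki
        have hxi : x i = shiftBy x k i + 1 := by simp [shiftBy, hki]
        rw [if_pos ⟨hxi, hyes⟩]
        simp [stepWeight, hki, hh]
      · have hxi : shiftBy x k i = x i := by simp [shiftBy, hki]
        rw [if_neg (by simp [hxi]), if_pos ⟨hxi.symm, hyes⟩]
        by_cases hh : isHead x i <;> simp [stepWeight, hki, hh]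
  · push Not at hk
    obtain ⟨i, hi, hki⟩ := hk
    have hki : k i = true := by simpa using hki
    rw [prod_eq_zero (mem_univ i) (by simp [stepWeight, hi, hki])]
    split_ifs with hm
    · rw [T0, Tstep_shiftBy_eq_zero hx hm hi hki, mul_zero]
    · rfl

lemma sum_stepWeight_mul_zpow {v : ℝ} (hv1 : v < 1) {P : ℕ} (x : Fin P → ℤ) (i : Fin P) {w : ℂ}
    (hw : w ≠ 0) :
    ∑ b : Bool, (stepWeight v x i b : ℂ) * w ^ (-(x i - if b then 1 else 0)) =
      (if i ∈ univ.filter (fun i => ¬ isHead x i) then 1 else (1 - v) * (1 + lam v * w)) *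
        w ^ (-x i) := by
  have hv' : (1 - v : ℂ) ≠ 0 := by exact_mod_cast (sub_pos.2 hv1).ne'
  have hz : w ^ (1 - x i) = w * w ^ (-x i) := by
    rw [sub_eq_add_neg, zpow_add₀ hw, zpow_one]
  by_cases hh : isHead x i
  · simp [stepWeight, hh, lam, hz]
    field_simp
    ring
  · simp [stepWeight, hh]

/-- The Bethe function `B` is an eigenfunction of the transformed evolution operator `T₀`
with eigenvalue `Λ(Z) = (1-v)^P ∏ (1+λ z_i)`. -/
theorem bethe_eigenfunction
    (v : ℝ) (hv0 : 0 < v) (hv1 : v < 1) (P : ℕ) (hP : 1 ≤ P)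
    (z : Fin P → ℂ)
    (hz : ∀ i, z i ≠ 0 ∧ z i ≠ 1 ∧ z i ≠ -(((1 - v) / v : ℝ) : ℂ))
    (x : Fin P → ℤ) (hx : StrictMono x) :
    ∑ k : Fin P → Bool,
        (if StrictMono (shiftBy x k) then
          (T0 v x (shiftBy x k) : ℂ) * betheB v z (shiftBy x k)
        else 0)
      = ((1 - v : ℝ) : ℂ) ^ P * (∏ i : Fin P, (1 + (lam v : ℂ) * z i)) *
          betheB v z x := by
  have hξ : ∀ i, xiC v (z i) ≠ 0 := fun i => xiC_ne_zero_s15 hv0 hv1 (hz i).1 (hz i).2.1 (hz i).2.2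
  have hφ : ∀ σ : Equiv.Perm (Fin P),
      ∑ k : Fin P → Bool, (∏ i, (stepWeight v x i (k i) : ℂ)) *
        ∏ i, z (σ i) ^ (-(shiftBy x k i)) =
      ∏ i, ((if i ∈ univ.filter (fun i => ¬ isHead x i) then 1
        else (1 - v) * (1 + lam v * z (σ i))) * z (σ i) ^ (-x i)) := by
    intro σ
    simp_rw [← sum_stepWeight_mul_zpow hv1 x _ (hz (σ _)).1, prod_univ_sum,
      Fintype.piFinset_univ, prod_mul_distrib, shiftBy]
  have hL : ∑ k : Fin P → Bool, (if StrictMono (shiftBy x k) then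
        (T0 v x (shiftBy x k) : ℂ) * betheB v z (shiftBy x k) else 0) =
      ∑ σ, ampA v z σ * ∏ i, ((if i ∈ univ.filter (fun i => ¬ isHead x i) then 1
        else (1 - v) * (1 + lam v * z (σ i))) * z (σ i) ^ (-x i)) := by
    simp_rw [← hφ, mul_sum]
    rw [sum_comm]
    refine sum_congr rfl fun k _ => ?_
    have h := congrArg (fun r : ℝ => (r : ℂ)) (T0_eq_prod_stepWeight hv1 hx k)
    simp only [Complex.ofReal_prod] at h
    rw [← h, betheB, betheSum]
    split_ifs with hm
    · rw [mul_sum]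
      exact sum_congr rfl fun σ _ => by ring
    · simp
  have hR : ((1 - v : ℝ) : ℂ) ^ P * (∏ i : Fin P, (1 + (lam v : ℂ) * z i)) * betheB v z x =
      ∑ σ, ampA v z σ * ∏ i, ((1 - v) * (1 + lam v * z (σ i)) * z (σ i) ^ (-x i)) := by
    rw [betheB, betheSum, mul_sum]
    refine sum_congr rfl fun σ _ => ?_
    rw [prod_mul_distrib, prod_mul_distrib, Equiv.prod_comp σ fun m => 1 + (lam v : ℂ) * z m]
    simp
    ring
  rw [hL, hR, sum_ampA_mul_prod hξ fun i w =>
      (if i ∈ univ.filter (fun i => ¬ isHead x i) then 1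
        else (1 - v) * (1 + lam v * w)) * w ^ (-x i),
    sum_ampA_mul_prod hξ fun i w => (1 - v) * (1 + lam v * w) * w ^ (-x i),
    det_eq_of_forall_not_isHead hv1 (fun i => (hz i).1) (fun i => (hz i).2.1) hξ hx _
      fun i hi => (mem_filter.1 hi).2]

end

end TASEP
end

section
/- (Schütz determinant formula for the TASEP with backward sequential update.) For all t ∈ ℕ, every initial configuration X⁰ and every configuration X of P particles: P^bw_t(X) = det[F_{i−j}(x_i − x⁰_j | t)]_{i,j=1,…,P}. -/
open Finset

namespace TASEP

attribute [local instance] Classical.propDecidable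

noncomputable section

/-- Coefficient of `z^k` in the expansion of `(1 - z)^(-m)`. -/
def negBinom (m : ℤ) (k : ℕ) : ℝ :=
  if 0 < m then ((k + m.toNat - 1).choose (m.toNat - 1) : ℝ)
  else (-1 : ℝ) ^ k * (m.natAbs.choose k : ℝ)

lemma negBinom_zero_right (m : ℤ) : negBinom m 0 = 1 := by
  unfold negBinom
  split_ifs <;> simp

lemma negBinom_succ_sub (m : ℤ) (k : ℕ) :
    negBinom m (k + 1) - negBinom m k = negBinom (m - 1) (k + 1) := by
  rcases le_or_gt m 0 with hm | hm
  · obtain ⟨n, rfl⟩ : ∃ n : ℕ, m = -n := ⟨m.natAbs, by omega⟩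
    have h1 : ¬ (0 : ℤ) < -n := by omega
    have h2 : ¬ (0 : ℤ) < -n - 1 := by omega
    have h3 : (-(n : ℤ)).natAbs = n := by omega
    have h4 : (-(n : ℤ) - 1).natAbs = n + 1 := by omega
    simp only [negBinom, h1, h2, h3, h4, if_false, Nat.choose_succ_succ']
    push_cast
    ring
  · obtain ⟨n, rfl⟩ : ∃ n : ℕ, m = n + 1 := ⟨(m - 1).toNat, by omega⟩
    have h3 : ((n : ℤ) + 1).toNat = n + 1 := by omega
    rcases n with _ | n
    · simp [negBinom]
    · have h4 : (((n + 1 : ℕ) : ℤ) + 1 - 1).toNat = n + 1 := by omega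
      have h5 : (0 : ℤ) < ((n + 1 : ℕ) : ℤ) + 1 - 1 := by omega
      have h6 : k + 1 + (n + 1 + 1) - 1 = (k + n + 1) + 1 := by omega
      have h7 : k + (n + 1 + 1) - 1 = k + n + 1 := by omega
      have h8 : k + 1 + (n + 1) - 1 = k + n + 1 := by omega
      simp only [negBinom, hm, h3, h4, h5, h6, h7, h8, if_true, Nat.add_sub_cancel,
        Nat.choose_succ_succ']
      push_cast
      ring

lemma negBinom_eq_zero {m : ℤ} {k : ℕ} (hm : m ≤ 0) (hk : -m < k) : negBinom m k = 0 := by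
  rw [negBinom, if_neg (by omega), Nat.choose_eq_zero_of_lt (by omega)]
  simp

lemma F0_eq_zero_of_lt (v : ℝ) {N : ℤ} {t : ℕ} (h : (t : ℤ) < N) : F0 v N t = 0 :=
  if_neg (by omega)

lemma F0_time_zero (v : ℝ) (N : ℤ) : F0 v N 0 = if N = 0 then 1 else 0 := by
  unfold F0
  by_cases h : N = 0
  · simp [h]
  · rw [if_neg (by push_cast; omega), if_neg h]

lemma F0_succ (v : ℝ) (N : ℤ) (t : ℕ) :
    F0 v N (t + 1) = v * F0 v (N - 1) t + (1 - v) * F0 v N t := by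
  rcases lt_trichotomy N 0 with h | rfl | h
  · simp only [F0]
    rw [if_neg (by omega), if_neg (by omega), if_neg (by omega)]
    ring
  · have h : (0 : ℤ) ≤ t + 1 := by omega
    simp [F0, pow_succ', h]
  · obtain ⟨n, rfl⟩ : ∃ n : ℕ, N = n + 1 := ⟨(N - 1).toNat, by omega⟩
    have h1 : ((n : ℤ) + 1).toNat = n + 1 := by omega
    have h2 : ((n : ℤ) + 1 - 1).toNat = n := by omega
    simp only [F0, h1, h2, Nat.add_sub_add_right]
    rcases lt_trichotomy n t with hn | rfl | hn
    · rw [if_pos (by omega), if_pos (by omega), if_pos (by omega)]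
      obtain ⟨d, rfl⟩ : ∃ d, t = n + 1 + d := ⟨t - (n + 1), by omega⟩
      have h3 : n + 1 + d - n = d + 1 := by omega
      rw [h3, Nat.add_sub_cancel_left, Nat.choose_succ_succ']
      push_cast
      ring
    · rw [if_pos (by omega), if_pos (by omega), if_neg (by omega)]
      simp
      ring
    · rw [if_neg (by omega), if_neg (by omega), if_neg (by omega)]
      ring

lemma summable_mul_F0 (v : ℝ) (c : ℕ → ℝ) (N : ℤ) (t : ℕ) :
    Summable fun k : ℕ => c k * F0 v (N + k) t := by
  refine summable_of_ne_finset_zero (s := Finset.range ((t - N).toNat + 1)) fun k hk => ?_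
  rw [Finset.mem_range, not_lt] at hk
  rw [F0_eq_zero_of_lt v (by omega), mul_zero]

lemma Fm_eq_tsum (v : ℝ) (m N : ℤ) (t : ℕ) :
    Fm v m N t = ∑' k : ℕ, negBinom m k * F0 v (N + k) t := by
  unfold Fm
  split_ifs with h1 h2
  · simp only [negBinom, h1, if_true]
  · subst h2
    rw [tsum_eq_single 0]
    · simp [negBinom_zero_right]
    · intro k hk
      rw [negBinom_eq_zero le_rfl (by omega), zero_mul]
  · rw [tsum_eq_sum (s := Finset.range (m.natAbs + 1))]
    · simp only [negBinom, h1, if_false]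
    · intro k hk
      rw [Finset.mem_range, not_lt] at hk
      rw [negBinom_eq_zero (by omega) (by omega), zero_mul]

lemma Fm_succ (v : ℝ) (m N : ℤ) (t : ℕ) :
    Fm v m N (t + 1) = v * Fm v m (N - 1) t + (1 - v) * Fm v m N t := by
  simp only [Fm_eq_tsum]
  rw [← tsum_mul_left, ← tsum_mul_left, ← Summable.tsum_add
    ((summable_mul_F0 v _ _ t).mul_left v) ((summable_mul_F0 v _ _ t).mul_left (1 - v))]
  refine tsum_congr fun k => ?_
  rw [F0_succ, show N + (k : ℤ) - 1 = N - 1 + k by ring]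
  ring

lemma Fm_add_one_right (v : ℝ) (m N : ℤ) (t : ℕ) :
    Fm v m (N + 1) t = Fm v m N t - Fm v (m - 1) N t := by
  have hs : ∀ k : ℕ, N + ((k + 1 : ℕ) : ℤ) = N + 1 + k := fun k => by push_cast; ring
  simp only [Fm_eq_tsum]
  rw [(summable_mul_F0 v (negBinom m) N t).tsum_eq_zero_add,
    (summable_mul_F0 v (negBinom (m - 1)) N t).tsum_eq_zero_add]
  simp only [negBinom_zero_right, hs]
  rw [add_sub_add_left_eq_sub, ← Summable.tsum_sub
    (summable_mul_F0 v (fun k => negBinom m (k + 1)) (N + 1) t)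
    (summable_mul_F0 v (fun k => negBinom (m - 1) (k + 1)) (N + 1) t)]
  refine tsum_congr fun k => ?_
  rw [← negBinom_succ_sub]
  ring

lemma Fm_time_zero_of_pos (v : ℝ) (m : ℤ) {N : ℤ} (hN : 0 < N) : Fm v m N 0 = 0 := by
  rw [Fm_eq_tsum]
  refine (tsum_congr fun k => ?_).trans tsum_zero
  rw [F0_eq_zero_of_lt v (by push_cast; omega), mul_zero]

lemma Fm_time_zero_of_lt (v : ℝ) {m N : ℤ} (hm : m ≤ 0) (hN : N < m) : Fm v m N 0 = 0 := by
  rw [Fm_eq_tsum]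
  refine (tsum_congr fun k => ?_).trans tsum_zero
  rw [F0_time_zero]
  split_ifs with h
  · rw [negBinom_eq_zero hm (by omega), zero_mul]
  · rw [mul_zero]

/-- The matrix `[F_{i-j}(x_i - y_j | t)]`. -/
def bwMatrix (v : ℝ) {P : ℕ} (x y : Fin P → ℤ) (t : ℕ) : Matrix (Fin P) (Fin P) ℝ :=
  Matrix.of fun i j => Fm v ((i : ℤ) - (j : ℤ)) (x i - y j) t

lemma det_eq_zero_of_corner_eq_zero {P : ℕ} (A : Matrix (Fin P) (Fin P) ℝ) (i : Fin P)
    (h : ∀ a b, i ≤ a → b ≤ i → A a b = 0) : A.det = 0 := by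
  rw [← Matrix.det_transpose, Matrix.det_apply]
  refine Finset.sum_eq_zero fun σ _ => ?_
  obtain ⟨a, ha, hb⟩ : ∃ a, i ≤ a ∧ σ a ≤ i := by
    by_contra! hcon
    have hsub : (Finset.Ici i).map σ.toEmbedding ⊆ Finset.Ioi i := by
      intro b hb
      obtain ⟨a, ha, rfl⟩ := Finset.mem_map.1 hb
      exact Finset.mem_Ioi.2 (hcon a (Finset.mem_Ici.1 ha))
    have := Finset.card_le_card hsub
    rw [Finset.card_map, Fin.card_Ici, Fin.card_Ioi] at this
    omega
  rw [Finset.prod_eq_zero (Finset.mem_univ a) (h a (σ a) ha hb), smul_zero]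

lemma sub_le_sub_of_strictMono {P : ℕ} {x : Fin P → ℤ} (hx : StrictMono x) {i j : Fin P}
    (hij : i ≤ j) : x i - (i : ℤ) ≤ x j - (j : ℤ) := by
  suffices ∀ n : ℕ, ∀ h : (i : ℕ) + n < P, x i + n ≤ x ⟨i + n, h⟩ by
    have h1 : (i : ℕ) + ((j : ℕ) - i) = j := by have := Fin.le_def.1 hij; omega
    have h2 := this ((j : ℕ) - i) (by omega)
    have h3 : (⟨(i : ℕ) + ((j : ℕ) - i), by omega⟩ : Fin P) = j := Fin.ext h1
    rw [h3] at h2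
    omega
  intro n
  induction n with
  | zero => simp
  | succ n ih =>
    intro h
    have h1 := ih (by omega)
    have h2 : x ⟨i + n, by omega⟩ < x ⟨i + (n + 1), h⟩ := hx (by simp [Fin.lt_def])
    push_cast
    omega

lemma det_bwMatrix_time_zero (v : ℝ) {P : ℕ} {x y : Fin P → ℤ} (hx : StrictMono x)
    (hy : StrictMono y) : (bwMatrix v x y 0).det = if x = y then 1 else 0 := by
  split_ifs with hxy
  · subst hxy
    rw [Matrix.det_of_isUpperTriangular]
    · refine Finset.prod_eq_one fun i _ => ?_
      simp [bwMatrix, Fm, F0_time_zero]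
    · intro i j hij
      have : x j < x i := hx hij
      exact Fm_time_zero_of_pos v _ (by omega)
  · obtain ⟨i, hi⟩ := Function.ne_iff.1 hxy
    rcases lt_or_gt_of_ne hi with hi | hi
    · rw [← Matrix.det_transpose]
      refine det_eq_zero_of_corner_eq_zero _ i fun a b ha hb => ?_
      have h1 := sub_le_sub_of_strictMono hx hb
      have h2 := sub_le_sub_of_strictMono hy ha
      have h3 := Fin.le_def.1 (hb.trans ha)
      exact Fm_time_zero_of_lt v (by omega) (by omega)
    · refine det_eq_zero_of_corner_eq_zero _ i fun a b ha hb => ?_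
      have h1 := hx.monotone ha
      have h2 := hy.monotone hb
      exact Fm_time_zero_of_pos v _ (by omega)

/-- Jump probability of a free particle. -/
def freeWeight (v : ℝ) (b : Bool) : ℝ := if b then v else 1 - v

lemma det_bwMatrix_succ (v : ℝ) {P : ℕ} (x y : Fin P → ℤ) (t : ℕ) :
    (bwMatrix v x y (t + 1)).det
      = ∑ k : Fin P → Bool, (∏ i, freeWeight v (k i)) * (bwMatrix v (shiftBy x k) y t).det := by
  have hrow : bwMatrix v x y (t + 1) = fun i : Fin P => ∑ b : Bool,
      freeWeight v b • fun j : Fin P =>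
        Fm v ((i : ℤ) - (j : ℤ)) (x i - (if b then 1 else 0) - y j) t := by
    funext i j
    have h : x i - 1 - y j = x i - y j - 1 := by ring
    simp [bwMatrix, freeWeight, Fm_succ, h]
  rw [hrow]
  refine (MultilinearMap.map_sum (Matrix.detRowAlternating (n := Fin P) (R := ℝ)).toMultilinearMap
    (fun (i : Fin P) (b : Bool) => freeWeight v b • fun j : Fin P =>
        Fm v ((i : ℤ) - (j : ℤ)) (x i - (if b then 1 else 0) - y j) t)).trans ?_
  refine Finset.sum_congr rfl fun k _ => ?_
  exact MultilinearMap.map_smul_univ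
    (Matrix.detRowAlternating (n := Fin P) (R := ℝ)).toMultilinearMap _ _

lemma det_bwMatrix_eq_of_collision (v : ℝ) {P : ℕ} {x x' : Fin P → ℤ} (y : Fin P → ℤ) (t : ℕ)
    (s : Fin P) (hs : (s : ℕ) + 1 < P) (hxs : x ⟨s + 1, hs⟩ = x s)
    (hx' : x' = Function.update x ⟨s + 1, hs⟩ (x s + 1)) :
    (bwMatrix v x' y t).det = (bwMatrix v x y t).det := by
  have hne : (⟨s + 1, hs⟩ : Fin P) ≠ s := by simp [Fin.ext_iff]
  rw [← Matrix.det_updateRow_add_smul_self (bwMatrix v x y t) hne (-1)]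
  congr 1
  ext i j
  rw [Matrix.updateRow_apply]
  split_ifs with hi
  · subst hi
    have h1 : x s + 1 - y j = x s - y j + 1 := by ring
    have h2 : (s : ℤ) + 1 - j - 1 = s - j := by ring
    simp only [bwMatrix, hx', Matrix.of_apply, Function.update_self, Pi.add_apply, Pi.smul_apply,
      hxs, h1, Nat.cast_add, Nat.cast_one, Fm_add_one_right, h2, smul_eq_mul]
    ring
  · simp [bwMatrix, hx', Function.update_of_ne hi]

/-- Weight of the jump of particle `i` for the jump pattern `k` ending in the configuration `x`. -/
def jumpWeight (v : ℝ) {P : ℕ} (x : Fin P → ℤ) (k : Fin P → Bool) (i : Fin P) : ℝ :=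
  if h : (i : ℕ) + 1 < P then
    if x ⟨i + 1, h⟩ = x i + 1 ∧ k i = false then (if k ⟨i + 1, h⟩ then 0 else 1)
    else freeWeight v (k i)
  else freeWeight v (k i)

lemma prod_jumpWeight (v : ℝ) {P : ℕ} {x : Fin P → ℤ} (hx : StrictMono x) (k : Fin P → Bool) :
    ∏ i, jumpWeight v x k i = if StrictMono (shiftBy x k) then TBw v x (shiftBy x k) else 0 := by
  split_ifs with hk
  · refine Finset.prod_congr rfl fun i _ => ?_
    unfold jumpWeight
    by_cases h : (i : ℕ) + 1 < P
    · have h1 : x i < x ⟨i + 1, h⟩ := hx (by simp [Fin.lt_def])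
      have h2 : shiftBy x k i < shiftBy x k ⟨i + 1, h⟩ := hk (by simp [Fin.lt_def])
      simp only [shiftBy] at h2
      simp only [dif_pos h, shiftBy, freeWeight]
      rcases Bool.eq_false_or_eq_true (k i) with h3 | h3 <;>
        rcases Bool.eq_false_or_eq_true (k ⟨i + 1, h⟩) with h4 | h4 <;>
        simp only [h3, h4, if_true] at h2 ⊢ <;> grind
    · simp only [dif_neg h, shiftBy, freeWeight]
      rcases Bool.eq_false_or_eq_true (k i) with h3 | h3 <;> simp [h3]
  · rcases P with _ | P
    · exact absurd (Subsingleton.strictMono _) hk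
    obtain ⟨i, hi⟩ : ∃ i : Fin P, ¬ shiftBy x k i.castSucc < shiftBy x k i.succ := by
      by_contra! hcon
      exact hk (Fin.strictMono_iff_lt_succ.2 hcon)
    refine Finset.prod_eq_zero (Finset.mem_univ i.castSucc) ?_
    have h : ((i.castSucc : Fin (P + 1)) : ℕ) + 1 < P + 1 := by simp
    have hsucc : (⟨(i.castSucc : Fin (P + 1)) + 1, h⟩ : Fin (P + 1)) = i.succ := rfl
    have h1 : x i.castSucc < x i.succ := hx Fin.castSucc_lt_succ
    rw [jumpWeight, dif_pos h, hsucc]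
    simp only [shiftBy] at hi
    rcases Bool.eq_false_or_eq_true (k i.castSucc) with h3 | h3 <;>
      rcases Bool.eq_false_or_eq_true (k i.succ) with h4 | h4 <;>
      simp only [h3, h4, if_true] at hi ⊢ <;> grind

lemma prod_eq_mul_mul_prod_erase {P : ℕ} (u : Fin P → ℝ) {a b : Fin P} (hab : b ≠ a) :
    ∏ i, u i = u a * (u b * ∏ i ∈ (univ.erase a).erase b, u i) := by
  rw [mul_prod_erase _ u (by simp [hab]), mul_prod_erase _ u (mem_univ a)]

/-- Product of the weights where the particles below `s` interact and the others are free. -/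
def partialWeight (v : ℝ) {P : ℕ} (x : Fin P → ℤ) (s : ℕ) (k : Fin P → Bool) : ℝ :=
  ∏ i : Fin P, if (i : ℕ) < s then jumpWeight v x k i else freeWeight v (k i)

lemma partialWeight_succ_of_eq (v : ℝ) {P : ℕ} (x : Fin P → ℤ) (s : ℕ) (k : Fin P → Bool)
    (h : ∀ i : Fin P, (i : ℕ) = s → jumpWeight v x k i = freeWeight v (k i)) :
    partialWeight v x (s + 1) k = partialWeight v x s k := by
  refine Finset.prod_congr rfl fun i _ => ?_
  rcases lt_trichotomy (i : ℕ) s with hi | hi | hi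
  · rw [if_pos hi, if_pos (by omega)]
  · rw [if_pos (by omega), if_neg (by omega), h i hi]
  · rw [if_neg (by omega), if_neg (by omega)]

lemma partialWeight_pair_cancel (v : ℝ) {P : ℕ} (x y : Fin P → ℤ) (t : ℕ) (a : Fin P)
    (ha : (a : ℕ) + 1 < P) (hxa : x ⟨a + 1, ha⟩ = x a + 1) {k k' : Fin P → Bool}
    (hk : k a = false) (hk1 : k ⟨a + 1, ha⟩ = true)
    (hk' : k' = Function.update k ⟨a + 1, ha⟩ false) :
    (partialWeight v x (a + 1) k - partialWeight v x a k) * (bwMatrix v (shiftBy x k) y t).det +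
      (partialWeight v x (a + 1) k' - partialWeight v x a k') *
        (bwMatrix v (shiftBy x k') y t).det = 0 := by
  have hne : (⟨a + 1, ha⟩ : Fin P) ≠ a := by simp [Fin.ext_iff]
  have hoff : ∀ i, i ≠ ⟨a + 1, ha⟩ → k' i = k i := fun i hi => by
    rw [hk', Function.update_of_ne hi]
  have hk'a : k' a = false := by rw [hoff a hne.symm, hk]
  have hk'1 : k' ⟨a + 1, ha⟩ = false := by rw [hk', Function.update_self]
  have hdet : (bwMatrix v (shiftBy x k') y t).det = (bwMatrix v (shiftBy x k) y t).det := by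
    refine det_bwMatrix_eq_of_collision v y t a ha (by simp [shiftBy, hk, hk1, hxa]) ?_
    funext i
    by_cases hi : i = ⟨a + 1, ha⟩
    · subst hi
      simp [shiftBy, hk'1, hk, hxa]
    · simp [shiftBy, hoff i hi, Function.update_of_ne hi]
  obtain ⟨R, hR⟩ : ∃ R : ℝ, ∀ s, (s = (a : ℕ) ∨ s = a + 1) → ∀ l, (l = k ∨ l = k') →
      ∏ i ∈ (univ.erase a).erase ⟨a + 1, ha⟩,
        (if (i : ℕ) < s then jumpWeight v x l i else freeWeight v (l i)) = R := by
    refine ⟨∏ i ∈ (univ.erase a).erase ⟨a + 1, ha⟩,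
      (if (i : ℕ) < a then jumpWeight v x k i else freeWeight v (k i)), fun s hs l hl => ?_⟩
    refine Finset.prod_congr rfl fun i hi => ?_
    have hi1 : i ≠ ⟨a + 1, ha⟩ := (Finset.mem_erase.1 hi).1
    have hia : (i : ℕ) ≠ a := fun h =>
      (Finset.mem_erase.1 (Finset.mem_erase.1 hi).2).1 (Fin.ext h)
    have hl' : ∀ j, j ≠ ⟨a + 1, ha⟩ → l j = k j := by
      rcases hl with rfl | rfl
      · exact fun _ _ => rfl
      · exact hoff
    by_cases h : (i : ℕ) < a
    · have h1 : (⟨i + 1, by omega⟩ : Fin P) ≠ ⟨a + 1, ha⟩ := by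
        simp only [ne_eq, Fin.mk.injEq]; omega
      rw [if_pos h, if_pos (by omega), jumpWeight, jumpWeight, dif_pos (by omega),
        dif_pos (by omega), hl' i hi1, hl' _ h1]
    · rw [if_neg h, if_neg (by omega), hl' i hi1]
  have hw : ∀ s, (s = (a : ℕ) ∨ s = a + 1) → ∀ l, (l = k ∨ l = k') →
      partialWeight v x s l = (if (a : ℕ) < s then jumpWeight v x l a else freeWeight v (l a)) *
        (freeWeight v (l ⟨a + 1, ha⟩) * R) := by
    intro s hs l hl
    rw [partialWeight, prod_eq_mul_mul_prod_erase _ hne, hR s hs l hl,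
      if_neg (show ¬ ((⟨a + 1, ha⟩ : Fin P) : ℕ) < s by simp only; omega)]
  rw [hw _ (.inr rfl) k (.inl rfl), hw _ (.inl rfl) k (.inl rfl), hw _ (.inr rfl) k' (.inr rfl),
    hw _ (.inl rfl) k' (.inr rfl), hdet]
  simp only [jumpWeight, freeWeight, dif_pos ha, hxa, hk, hk1, hk'a, hk'1]
  simp
  ring

lemma sum_partialWeight (v : ℝ) {P : ℕ} (x y : Fin P → ℤ) (t s : ℕ) :
    ∑ k : Fin P → Bool, partialWeight v x s k * (bwMatrix v (shiftBy x k) y t).det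
      = ∑ k : Fin P → Bool, (∏ i, freeWeight v (k i)) * (bwMatrix v (shiftBy x k) y t).det := by
  induction s with
  | zero => simp [partialWeight]
  | succ s ih =>
    rw [← ih, ← sub_eq_zero, ← Finset.sum_sub_distrib]
    simp only [← sub_mul]
    by_cases hcl : ∃ (a : Fin P) (ha : (a : ℕ) + 1 < P), (a : ℕ) = s ∧ x ⟨a + 1, ha⟩ = x a + 1
    · obtain ⟨a, ha, rfl, hxa⟩ := hcl
      have hne : (⟨a + 1, ha⟩ : Fin P) ≠ a := by simp [Fin.ext_iff]
      refine Finset.sum_involution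
        (fun k _ => Function.update k ⟨a + 1, ha⟩ (!k ⟨a + 1, ha⟩)) (fun k _ => ?_)
        (fun k _ _ h => by simpa using congrFun h ⟨a + 1, ha⟩) (fun _ _ => Finset.mem_univ _)
        (fun k _ => by simp)
      by_cases hk : k a = false
      · rcases Bool.eq_false_or_eq_true (k ⟨a + 1, ha⟩) with hk1 | hk1
        · exact partialWeight_pair_cancel v x y t a ha hxa hk hk1 (by rw [hk1]; rfl)
        · rw [add_comm]
          refine partialWeight_pair_cancel v x y t a ha hxa ?_ (by simp [hk1]) ?_
          · rw [Function.update_of_ne hne.symm, hk]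
          · rw [Function.update_idem, ← hk1, Function.update_eq_self]
      · rw [partialWeight_succ_of_eq, partialWeight_succ_of_eq, sub_self, sub_self]
        · simp
        all_goals
          intro i hi
          obtain rfl : i = a := Fin.ext hi
          simp [jumpWeight, ha, hk, Function.update_of_ne hne.symm]
    · refine Finset.sum_eq_zero fun k _ => ?_
      rw [partialWeight_succ_of_eq, sub_self, zero_mul]
      intro i hi
      unfold jumpWeight
      split_ifs with h1 h2
      · exact absurd ⟨i, h1, hi, h2.1⟩ hcl
      · exact absurd ⟨i, h1, hi, h2.1⟩ hcl
      · rfl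
      · rfl

/-- Schütz determinant formula for the TASEP with backward sequential update:
`P^bw_t(X) = det [F_{i-j}(x_i - x⁰_j | t)]`. -/
theorem backward_tasep_determinant
    (v : ℝ) (hv0 : 0 < v) (hv1 : v < 1) (P : ℕ) (hP : 1 ≤ P)
    (x0 x : Fin P → ℤ) (hx0 : StrictMono x0) (hx : StrictMono x) (t : ℕ) :
    Pbw v x0 t x
      = (Matrix.of fun i j : Fin P => Fm v ((i : ℤ) - (j : ℤ)) (x i - x0 j) t).det := by
  change _ = (bwMatrix v x x0 t).det
  induction t generalizing x with
  | zero => rw [det_bwMatrix_time_zero v hx hx0]; rfl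
  | succ t ih =>
    rw [det_bwMatrix_succ, ← sum_partialWeight v x x0 t P, Pbw]
    refine Finset.sum_congr rfl fun k _ => ?_
    simp only [partialWeight, Fin.is_lt, if_true]
    rw [prod_jumpWeight v hx]
    split_ifs with hk
    · rw [ih _ hk]
    · rw [zero_mul]

end

end TASEP
end

section
/- For all a, b ∈ ℤ and t ∈ ℕ: f(a,b,t) = (−1)^a·F̃_a(b|t); that is, the matrix elements of the analytic (Bethe-ansatz) determinant solution and of the combinatorial (trajectory-counting) determinant solution of the parallel-update TASEP coincide up to the sign (−1)^a. -/
open Finset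

namespace TASEP

attribute [local instance] Classical.propDecidable

noncomputable section

theorem C_eq_choose (n : ℤ) (k : ℕ) : C n k = ((Ring.choose n k : ℤ) : ℝ) := by
  have h : ∏ i ∈ Finset.range k, ((n : ℝ) - (i : ℝ)) =
      (k.factorial : ℝ) * ((Ring.choose n k : ℤ) : ℝ) := by
    have h1 := Ring.descPochhammer_eq_factorial_smul_choose n k
    rw [← Polynomial.eval_eq_smeval, descPochhammer_eval_eq_prod_range,
      nsmul_eq_mul] at h1
    exact_mod_cast congrArg (Int.cast : ℤ → ℝ) h1
  rw [C, h, mul_div_cancel_left₀ _ (Nat.cast_ne_zero.mpr k.factorial_ne_zero)]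

theorem C_natCast (n k : ℕ) : C (n : ℤ) k = (n.choose k : ℝ) := by
  rw [C_eq_choose, Ring.choose_natCast, Int.cast_natCast]

theorem C_neg (n : ℤ) (k : ℕ) : C (-n) k = (-1) ^ k * C (n + k - 1) k := by
  rw [C_eq_choose, C_eq_choose, Ring.choose_neg, Int.negOnePow_def]
  simp [Units.smul_def]

theorem C_add (r s : ℤ) (k : ℕ) :
    C (r + s) k = ∑ i ∈ Finset.range (k + 1), C s i * C r (k - i) := by
  rw [← Finset.Nat.sum_antidiagonal_eq_sum_range_succ (fun i j => C s i * C r j), add_comm r s]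
  simp only [C_eq_choose, Ring.add_choose_eq k (Commute.all s r), Int.cast_sum, Int.cast_mul]

/-- The coefficient of `z ^ x` in `(1 + l z) ^ r`, for an integer exponent `x`. -/
def binomCoeff (l : ℝ) (r x : ℤ) : ℝ :=
  if 0 ≤ x then C r x.toNat * l ^ x.toNat else 0

theorem binomCoeff_of_neg {l : ℝ} {r x : ℤ} (hx : x < 0) : binomCoeff l r x = 0 :=
  if_neg hx.not_ge

theorem binomCoeff_natCast_of_lt {l : ℝ} {t : ℕ} {x : ℤ} (hx : (t : ℤ) < x) :
    binomCoeff l t x = 0 := by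
  rw [binomCoeff, C_natCast, Nat.choose_eq_zero_of_lt (by omega)]
  simp

theorem tsum_C_mul_binomCoeff (l : ℝ) (r s x : ℤ) :
    ∑' i : ℕ, C s i * l ^ i * binomCoeff l r (x - i) = binomCoeff l (r + s) x := by
  rw [tsum_eq_sum (s := Finset.range (x.toNat + 1))]
  · rcases lt_or_ge x 0 with hx | hx
    · rw [binomCoeff_of_neg hx]
      exact Finset.sum_eq_zero fun i _ => by rw [binomCoeff_of_neg (by omega), mul_zero]
    · lift x to ℕ using hx
      rw [binomCoeff, if_pos (by omega), C_add, Finset.sum_mul, Int.toNat_natCast]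
      refine Finset.sum_congr rfl fun i hi => ?_
      have hi' : i ≤ x := Nat.lt_succ_iff.mp (Finset.mem_range.mp hi)
      have h1 : ((x : ℤ) - i).toNat = x - i := by omega
      rw [binomCoeff, if_pos (by omega), h1, ← pow_mul_pow_sub l hi']
      ring
  · intro i hi
    rw [Finset.mem_range] at hi
    rw [binomCoeff_of_neg (by omega), mul_zero]

theorem sum_choose_mul_binomCoeff (l : ℝ) (r x : ℤ) (m : ℕ) :
    ∑ n ∈ Finset.range (m + 1), (m.choose n : ℝ) * l ^ n * binomCoeff l r (x - n) =
      binomCoeff l (r + m) x := by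
  rw [← tsum_C_mul_binomCoeff, tsum_eq_sum (s := Finset.range (m + 1))]
  · simp only [C_natCast]
  · intro i hi
    rw [Finset.mem_range] at hi
    rw [C_natCast, Nat.choose_eq_zero_of_lt (by omega)]
    simp

theorem F0_eq_binomCoeff {v : ℝ} (hv : v < 1) (x : ℤ) (t : ℕ) :
    F0 v x t = (1 - v) ^ t * binomCoeff (lam v) t x := by
  have hne : (1 - v) ≠ 0 := (sub_pos.mpr hv).ne'
  rw [F0]
  split_ifs with h
  · obtain ⟨hx, hxt⟩ := h
    lift x to ℕ using hx
    have hxt' : x ≤ t := by exact_mod_cast hxt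
    rw [binomCoeff, if_pos (by omega), Int.toNat_natCast, C_natCast, lam, div_pow]
    rw [← Nat.sub_add_cancel hxt', pow_add, Nat.sub_add_cancel hxt']
    field_simp
  · rcases lt_or_ge x 0 with hx | hx
    · rw [binomCoeff_of_neg hx, mul_zero]
    · rw [binomCoeff_natCast_of_lt (by omega), mul_zero]

theorem tsum_int_ge_neg (n : ℕ) (g : ℤ → ℝ) :
    ∑' k : ℤ, (if -(n : ℤ) ≤ k then g k else 0) = ∑' j : ℕ, g (j - n) := by
  have hinj : Function.Injective fun j : ℕ => (j : ℤ) - n := fun i j h => by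
    simpa using h
  rw [← hinj.tsum_eq]
  · exact tsum_congr fun j => if_pos (by omega)
  · intro k hk
    rw [Function.mem_support, ne_eq, ite_eq_right_iff, not_forall] at hk
    obtain ⟨hk, -⟩ := hk
    exact ⟨(k + n).toNat, by simp only; omega⟩

theorem Ftil_of_pos {v : ℝ} (hv : v < 1) {m : ℕ} (hm : 0 < m) (b : ℤ) (t : ℕ) :
    Ftil v m b t = (1 - v) ^ t *
      ∑' j : ℕ, C (m + (j : ℤ) - 1) j * binomCoeff (lam v) (t + m) (b + j) := by
  rw [Ftil, if_pos (by exact_mod_cast hm), Int.toNat_natCast]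
  have hinner : ∀ n : ℕ, (∑' k : ℤ, if -(n : ℤ) ≤ k then
      (m.choose n : ℝ) * (((m : ℤ) + (n : ℤ) + k - 1).toNat.choose ((n : ℤ) + k).toNat : ℝ) *
        lam v ^ n * F0 v (b + k) t else 0) =
      ∑' j : ℕ, (1 - v) ^ t * (C (m + (j : ℤ) - 1) j *
        ((m.choose n : ℝ) * lam v ^ n * binomCoeff (lam v) t (b + j - n))) := by
    intro n
    rw [tsum_int_ge_neg]
    refine tsum_congr fun j => ?_
    have h1 : ((m : ℤ) + n + (j - n) - 1) = ((m + j - 1 : ℕ) : ℤ) := by omega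
    have h2 : ((n : ℤ) + (j - n)).toNat = j := by omega
    have h3 : (m : ℤ) + j - 1 = ((m + j - 1 : ℕ) : ℤ) := by omega
    rw [h1, h2, h3, Int.toNat_natCast, C_natCast, F0_eq_binomCoeff hv, add_sub_assoc]
    ring
  rw [Finset.sum_congr rfl fun n _ => hinner n, ← Summable.tsum_finsetSum, ← tsum_mul_left]
  · refine tsum_congr fun j => ?_
    rw [← Finset.mul_sum, ← Finset.mul_sum, sum_choose_mul_binomCoeff]
  · intro n _
    refine summable_of_ne_finset_zero (s := Finset.range (t + n + b.natAbs + 1)) fun j hj => ?_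
    rw [Finset.mem_range] at hj
    rw [binomCoeff_natCast_of_lt (by omega)]
    simp

theorem Ftil_neg {v : ℝ} (hv : v < 1) (m : ℕ) (b : ℤ) (t : ℕ) :
    Ftil v (-(m : ℤ)) b t = (1 - v) ^ t *
      ∑ n ∈ Finset.range (m + 1),
        (-1) ^ n * (m.choose n : ℝ) * binomCoeff (lam v) (t - m) (b + n) := by
  rcases Nat.eq_zero_or_pos m with rfl | hm
  · simp [Ftil, F0_eq_binomCoeff hv]
  rw [Ftil, if_neg (by omega), if_neg (by omega), Int.natAbs_neg, Int.natAbs_natCast,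
    Finset.mul_sum]
  refine Finset.sum_congr rfl fun n _ => ?_
  rw [tsum_int_ge_neg, sub_eq_add_neg (t : ℤ), ← tsum_C_mul_binomCoeff, ← tsum_mul_left,
    ← tsum_mul_left]
  refine tsum_congr fun j => ?_
  have h1 : ((m : ℤ) + n + (j - n) - 1) = ((m + j - 1 : ℕ) : ℤ) := by omega
  have h2 : ((n : ℤ) + (j - n)).toNat = j := by omega
  have h3 : (m : ℤ) + j - 1 = ((m + j - 1 : ℕ) : ℤ) := by omega
  have h4 : b - ((j : ℤ) - n) = b + n - j := by ring
  rw [h1, h2, C_neg, h3, h4, Int.toNat_natCast, C_natCast, F0_eq_binomCoeff hv, neg_pow (lam v)]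
  ring

theorem f_of_pos (v : ℝ) {a : ℤ} (ha : 1 ≤ a) (b : ℤ) (t : ℕ) :
    f v a b t = (1 - v) ^ t * (-1 : ℝ) ^ a *
      ∑' k : ℕ, C (a + (k : ℤ) - 1) k * binomCoeff (lam v) (t + a) (b + k) := by
  rw [f, if_pos ha]
  congr 1
  refine tsum_congr fun k => ?_
  rw [binomCoeff]
  split_ifs <;> ring

theorem f_neg (v : ℝ) (m : ℕ) (b : ℤ) (t : ℕ) :
    f v (-(m : ℤ)) b t = (1 - v) ^ t * (-1 : ℝ) ^ (-(m : ℤ)) *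
      ∑ n ∈ Finset.range (m + 1),
        (-1) ^ n * (m.choose n : ℝ) * binomCoeff (lam v) (t - m) (b + n) := by
  rw [f, if_neg (by omega), tsum_eq_sum (s := Finset.range (m + 1))]
  · congr 1
    refine Finset.sum_congr rfl fun n hn => ?_
    rw [Finset.mem_range] at hn
    have hn' : (n : ℤ) ≤ - -(m : ℤ) := by omega
    rw [binomCoeff, neg_neg, C_natCast, ← sub_eq_add_neg]
    rw [neg_neg] at hn'
    simp only [hn', true_and]
    split_ifs <;> ring
  · intro n hn
    rw [Finset.mem_range] at hn
    exact if_neg (by omega)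

/-- The analytic and combinatorial matrix elements coincide: `f(a,b,t) = (-1)^a F̃_a(b|t)`. -/
theorem f_eq_Ftilde (v : ℝ) (hv0 : 0 < v) (hv1 : v < 1) (a b : ℤ) (t : ℕ) :
    f v a b t = (-1 : ℝ) ^ a * Ftil v a b t := by
  rcases le_or_gt a 0 with ha | ha
  · obtain ⟨m, rfl⟩ : ∃ m : ℕ, a = -(m : ℤ) := ⟨a.natAbs, by omega⟩
    rw [f_neg, Ftil_neg hv1]
    ring
  · lift a to ℕ using ha.le
    rw [f_of_pos v ha, Ftil_of_pos hv1 (by exact_mod_cast ha)]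
    ring

end

end TASEP
end
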